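/- Gaussian sketching identity: let Ω ∈ K^{n×ℓ} be a Gaussian embedding partitioned as Ω = [Ω₁; Ω₂], where Ω₁ consists of the first r rows and Ω₂ of the last n − r rows, with r + α_K < ℓ. Then for any matrix B ∈ K^{(n−r)×p}, E‖(Ω₁*)⁺ Ω₂* B‖_F² = (r/(ℓ − r − α_K)) · ‖B‖_F². -/

import Mathlib

open MeasureTheory ProbabilityTheory Matrix Filter
open scoped ENNReal Topology ComplexOrder

noncomputable section

open Classical in
/-- `α_K`: 1 if `K = ℝ`, 0 if `K = ℂ`. -/
def alphaK (K : Type*) [RCLike K] : ℝ := if (RCLike.I : K) = 0 then 1 else 0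

/-- Squared Frobenius norm of a matrix. -/
def frobSq {K : Type*} [RCLike K] {m n : Type*} [Fintype m] [Fintype n]
    (A : Matrix m n K) : ℝ := ∑ i, ∑ j, ‖A i j‖ ^ 2

/-- The four Penrose conditions characterizing the Moore–Penrose pseudoinverse. -/
def IsMoorePenrose {K : Type*} [RCLike K] {m n : Type*} [Fintype m] [Fintype n]
    (A : Matrix m n K) (X : Matrix n m K) : Prop :=
  A * X * A = A ∧ X * A * X = X ∧ (A * X)ᴴ = A * X ∧ (X * A)ᴴ = X * A

instance matrixMeasurableSpace {m n α : Type*} [MeasurableSpace α] :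
    MeasurableSpace (Matrix m n α) :=
  inferInstanceAs (MeasurableSpace (m → n → α))

/-- `M` is rotation-invariant: `U * M` has the same distribution as `M` for every unitary `U`. -/
def RotationInvariant {K : Type*} [RCLike K] [MeasurableSpace K]
    {Y : Type*} [MeasurableSpace Y] (μ : Measure Y) {n ℓ : ℕ}
    (M : Y → Matrix (Fin n) (Fin ℓ) K) : Prop :=
  ∀ U : Matrix (Fin n) (Fin n) K, U ∈ Matrix.unitaryGroup (Fin n) K →
    Measure.map (fun ω => U * M ω) μ = Measure.map M μ

/-- `M` is a random orthonormal embedding: rotation-invariant, with orthonormal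
columns almost surely. -/
def IsRandomOrthonormal {K : Type*} [RCLike K] [MeasurableSpace K]
    {Y : Type*} [MeasurableSpace Y] (μ : Measure Y) {n ℓ : ℕ}
    (M : Y → Matrix (Fin n) (Fin ℓ) K) : Prop :=
  Measurable M ∧ RotationInvariant μ M ∧ ∀ᵐ ω ∂μ, (M ω)ᴴ * M ω = 1

open Classical in
/-- A standard normal sample in `K` built from two independent real coordinates:
for `K = ℝ` it is the first coordinate, for `K = ℂ` it is `(g₁ + i g₂)/√2`. -/
def stdGaussianEntry (K : Type*) [RCLike K] (v : Bool → ℝ) : K :=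
  if (RCLike.I : K) = 0 then (v false : K)
  else ((v false : K) + RCLike.I * (v true : K)) / (Real.sqrt 2 : K)

/-- The distribution of an `r × c` matrix with independent standard normal
`N_K(0,1)` entries. -/
def gaussianMatrix (K : Type*) [RCLike K] [MeasurableSpace K] (r c : ℕ) :
    Measure (Matrix (Fin r) (Fin c) K) :=
  Measure.map
    (fun g : Fin r → Fin c → Bool → ℝ => Matrix.of fun i j => stdGaussianEntry K (g i j))
    (Measure.pi fun _ : Fin r => Measure.pi fun _ : Fin c =>
      Measure.pi fun _ : Bool => gaussianReal 0 1)

/-- `M` is a Gaussian embedding: a random matrix with iid standard normal `N_K(0,1)` entries. -/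
def IsGaussianEmbedding {K : Type*} [RCLike K] [MeasurableSpace K]
    {Y : Type*} [MeasurableSpace Y] (μ : Measure Y) {n ℓ : ℕ}
    (M : Y → Matrix (Fin n) (Fin ℓ) K) : Prop :=
  Measurable M ∧ Measure.map M μ = gaussianMatrix K n ℓ


set_option linter.unusedSectionVars false

section Aux
variable {K : Type*} [RCLike K] [MeasurableSpace K] [BorelSpace K]

/-- the law of one entry -/
def nuK (K : Type*) [RCLike K] [MeasurableSpace K] : Measure K :=
  Measure.map (stdGaussianEntry K) (Measure.pi fun _ : Bool => gaussianReal 0 1)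

/-- variance of the real part -/
def sigK (K : Type*) [RCLike K] : ℝ := (1 + alphaK K) / 2

theorem entry_continuous : Continuous (stdGaussianEntry K) := by
  unfold stdGaussianEntry
  split_ifs
  · exact RCLike.continuous_ofReal.comp (continuous_apply false)
  · refine Continuous.div_const (Continuous.add ?_ (continuous_const.mul ?_)) _
    · exact RCLike.continuous_ofReal.comp (continuous_apply false)
    · exact RCLike.continuous_ofReal.comp (continuous_apply true)

instance nuK_prob : IsProbabilityMeasure (nuK K) :=
  Measure.isProbabilityMeasure_map entry_continuous.measurable.aemeasurable

/-- entry as a continuous linear map -/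
def entryL (K : Type*) [RCLike K] : (Bool → ℝ) →L[ℝ] K where
  toFun := stdGaussianEntry K
  map_add' x y := by
    unfold stdGaussianEntry
    split_ifs <;> simp <;> ring
  map_smul' c x := by
    unfold stdGaussianEntry
    split_ifs <;> simp [Algebra.smul_def] <;> ring
  cont := entry_continuous

instance secondCountK : SecondCountableTopology K :=
  secondCountable_of_proper

theorem pi_gauss {ι : Type*} [Fintype ι] {E : Type*} [NormedAddCommGroup E] [NormedSpace ℝ E]
    [CompleteSpace E] [SecondCountableTopology E] [MeasurableSpace E] [BorelSpace E] (ν : Measure E)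
    [IsGaussian ν] : IsGaussian (Measure.pi fun _ : ι => ν) := by
  have h := iIndepFun_pi (μ := fun _ : ι => ν) (X := fun _ => id) (fun _ => aemeasurable_id)
  have h2 := h.hasGaussianLaw (fun i => by
    constructor
    have : (Measure.map (fun ω : ι → E => id (ω i)) (Measure.pi fun _ : ι => ν)) = ν :=
      (measurePreserving_eval (fun _ : ι => ν) i).map_eq
    rw [this]; infer_instance)
  have := h2.isGaussian_map
  simpa using this

instance nuK_gauss : IsGaussian (nuK K) := by
  have := pi_gauss (ι := Bool) (gaussianReal 0 1)
  exact isGaussian_map (μ := Measure.pi fun _ : Bool => gaussianReal 0 1) (entryL K)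

theorem im_zero_of_I (h : (RCLike.I : K) = 0) (x : K) : RCLike.im x = 0 := by
  have := RCLike.re_add_im x
  rw [h, mul_zero, add_zero] at this
  rw [← this]; simp

theorem sq_norm_K (x : K) : ‖x‖^2 = RCLike.re x ^ 2 + RCLike.im x ^ 2 := by
  rw [RCLike.norm_sq_eq_def]; try ring

/-- real functional -/
def fL (u : K) : K →L[ℝ] ℝ := RCLike.reCLM.comp (ContinuousLinearMap.mul ℝ K u)

theorem fL_apply (u x : K) : fL u x = RCLike.re (u * x) := rfl

theorem nuK_fL_mean (u : K) : ∫ x, fL u x ∂(nuK K) = 0 := by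
  rw [nuK, integral_map entry_continuous.measurable.aemeasurable (by fun_prop)]
  have : ∀ v : Bool → ℝ, fL u (stdGaussianEntry K v) = 
      fL u (stdGaussianEntry K (Pi.single false 1)) * v false 
      + fL u (stdGaussianEntry K (Pi.single true 1)) * v true := by
    intro v
    have hv : v = v false • Pi.single false 1 + v true • Pi.single true 1 := by
      ext b; cases b <;> simp
    change ((fL u).comp (entryL K)) v = ((fL u).comp (entryL K)) _ * _ + ((fL u).comp (entryL K)) _ * _ 
    conv_lhs => rw [hv]
    rw [map_add, map_smul, map_smul]; simp [mul_comm]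
  have hi : ∀ b : Bool, Integrable (fun v : Bool → ℝ => v b) (Measure.pi fun _ : Bool => gaussianReal 0 1) := by
    intro b
    exact integrable_comp_eval (μ := fun _ : Bool => gaussianReal 0 1) (f := id) (i := b)
      (IsGaussian.integrable_id)
  have hz : ∀ b : Bool, ∫ v : Bool → ℝ, v b ∂(Measure.pi fun _ : Bool => gaussianReal 0 1) = 0 := by
    intro b
    have := integral_comp_eval (μ := fun _ : Bool => gaussianReal 0 1) (f := fun x : ℝ => x) (i := b)
      (by fun_prop)
    rw [this]; exact integral_id_gaussianReal
  rw [integral_congr_ae (ae_of_all _ this)]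
  rw [integral_add ((hi _).const_mul _) ((hi _).const_mul _), integral_const_mul, integral_const_mul, hz, hz]
  simp

theorem nuK_fL_var (u : K) : Var[fL u; nuK K] = sigK K * ‖u‖^2 := by
  rw [nuK, variance_map (by fun_prop) entry_continuous.measurable.aemeasurable]
  have key : ∀ a b : ℝ, (∀ v, fL u (stdGaussianEntry K v) = a * v false + b * v true) →
      Var[(fL u) ∘ stdGaussianEntry K; Measure.pi fun _ : Bool => gaussianReal 0 1] = a^2+b^2 := by
    intro a b h
    have := variance_sum_pi (μ := fun _ : Bool => gaussianReal 0 1)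
      (X := fun i x => (bif i then b else a) * x) 
      (fun i => (IsGaussian.memLp_id (gaussianReal 0 1) 2 (by norm_num)).const_mul _)
    have e : (fL u) ∘ stdGaussianEntry K = 
       ∑ i : Bool, fun ω : Bool → ℝ => (bif i then b else a) * ω i := by
      ext v; simp [h]; ring
    rw [e, this]
    have hv : ∀ c : ℝ, Var[fun x => c * x; gaussianReal 0 1] = c ^ 2 := by
      intro c
      rw [variance_const_mul c (fun x => x), variance_fun_id_gaussianReal]; simp
    simp only [hv]
    simp; ring
  rw [sq_norm_K]
  by_cases h : (RCLike.I : K) = 0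
  · rw [key (RCLike.re u) 0]
    · simp [sigK, alphaK, h, im_zero_of_I h]
    · intro v
      simp [fL_apply, stdGaussianEntry, h]
  · have h1 := RCLike.I_im (K := K)
    rw [key (RCLike.re u / √2) (- RCLike.im u / √2)]
    · simp [sigK, alphaK, h, div_pow]; ring
    · intro v
      have hI : RCLike.im (RCLike.I : K) = 1 := (RCLike.I_eq_zero_or_im_I_eq_one (K := K)).resolve_left h
      simp only [fL_apply, stdGaussianEntry, h, if_false]
      rw [← mul_div_assoc, RCLike.div_re_ofReal]
      simp [hI]; ring

end Aux

section Aux2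
variable {K : Type*} [RCLike K] [MeasurableSpace K] [BorelSpace K]

/-- real functional on vectors -/
def FL {ι : Type*} [Fintype ι] (u : ι → K) : (ι → K) →L[ℝ] ℝ :=
  ∑ i, (fL (u i)).comp (ContinuousLinearMap.proj i)

theorem FL_apply {ι : Type*} [Fintype ι] (u x : ι → K) :
    FL u x = RCLike.re (∑ i, u i * x i) := by
  simp [FL, fL_apply]

theorem FL_apply' {ι : Type*} [Fintype ι] (u x : ι → K) :
    FL u x = ∑ i, fL (u i) (x i) := by
  simp [FL]

/-- column measure -/
def piN (K : Type*) [RCLike K] [MeasurableSpace K] (ι : Type*) [Fintype ι] : Measure (ι → K) :=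
  Measure.pi fun _ => nuK K

instance piN_gauss {ι : Type*} [Fintype ι] : IsGaussian (piN K ι) := pi_gauss _

theorem FL_memLp {ι : Type*} [Fintype ι] (u : ι → K) : MemLp (FL u) 2 (piN K ι) :=
  ((IsGaussian.hasGaussianLaw_id (μ := piN K ι)).map (FL u)).memLp_two

theorem fL_memLp (u : K) : MemLp (fL u) 2 (nuK K) :=
  ((IsGaussian.hasGaussianLaw_id (μ := nuK K)).map (fL u)).memLp_two

theorem FL_mean {ι : Type*} [Fintype ι] (u : ι → K) : ∫ x, FL u x ∂(piN K ι) = 0 := by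
  simp_rw [FL_apply']
  rw [integral_finsetSum]
  · refine Finset.sum_eq_zero fun i _ => ?_
    have := integral_comp_eval (μ := fun _ : ι => nuK K) (f := fL (u i)) (i := i) (by fun_prop)
    rw [piN, this, nuK_fL_mean]
  · intro i _
    exact integrable_comp_eval (μ := fun _ : ι => nuK K) (f := fL (u i)) (i := i)
      ((fL_memLp (u i)).integrable (by norm_num))

theorem FL_var {ι : Type*} [Fintype ι] (u : ι → K) :
    Var[FL u; piN K ι] = sigK K * ∑ i, ‖u i‖ ^ 2 := by
  have := variance_sum_pi (μ := fun _ : ι => nuK K) (X := fun i => fL (u i))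
    (fun i => fL_memLp (u i))
  have e : (FL u : (ι → K) → ℝ) = ∑ i, fun ω : ι → K => fL (u i) (ω i) := by
    ext x; simp [FL_apply']
  rw [e, piN, this]
  simp_rw [nuK_fL_var, Finset.mul_sum]

theorem FL_cov {ι : Type*} [Fintype ι] (u v : ι → K) :
    cov[FL u, FL v; piN K ι] = sigK K * RCLike.re (∑ i, u i * star (v i)) := by
  have h1 := variance_add (FL_memLp u) (FL_memLp v)
  have e : (FL u : (ι → K) → ℝ) + FL v = FL (u + v) := by
    ext x; simp [FL_apply, add_mul, Finset.sum_add_distrib]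
  rw [e, FL_var, FL_var, FL_var] at h1
  have h2 : ∑ i, ‖(u + v) i‖ ^ 2 = ∑ i, ‖u i‖ ^ 2 + 2 * RCLike.re (∑ i, u i * star (v i))
      + ∑ i, ‖v i‖ ^ 2 := by
    rw [map_sum, Finset.mul_sum, ← Finset.sum_add_distrib, ← Finset.sum_add_distrib]
    refine Finset.sum_congr rfl fun i _ => ?_
    simp only [Pi.add_apply, sq_norm_K, RCLike.mul_re, RCLike.star_def, RCLike.conj_re, RCLike.conj_im, map_add]
    ring
  rw [h2] at h1
  linarith

theorem gauss_exp_sq (v : NNReal) (t : ℝ) (ht : 0 ≤ t) :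
    ∫ x, Real.exp (-t * x ^ 2) ∂(gaussianReal 0 v) = (1 + 2 * t * v) ^ (-(1/2) : ℝ) := by
  by_cases hv : v = 0
  · simp [hv]
  · have hv' : (0:ℝ) < v := by positivity
    rw [integral_gaussianReal_eq_integral_smul hv]
    have : ∀ x : ℝ, gaussianPDFReal 0 v x • Real.exp (-t * x ^ 2)
      = (√(2 * Real.pi * v))⁻¹ * Real.exp (-(t + 1 / (2 * v)) * x ^ 2) := by
      intro x
      rw [gaussianPDFReal, smul_eq_mul, mul_assoc, ← Real.exp_add]
      congr 2
      field_simp; ring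
    simp_rw [this]
    rw [integral_const_mul, integral_gaussian, Real.rpow_neg (by positivity), ← Real.sqrt_eq_rpow,
      ← Real.sqrt_inv, ← Real.sqrt_inv, ← Real.sqrt_mul (by positivity)]
    congr 1
    have := Real.pi_pos
    have h3 : 0 < 1 + 2 * t * v := by positivity
    field_simp
    ring

theorem exp_FL {ι κ : Type*} [Fintype ι] [Fintype κ] (u : κ → ι → K)
    (hu : ∀ a b, a ≠ b → RCLike.re (∑ i, u a i * star (u b i)) = 0) (t : ℝ) (ht : 0 ≤ t) :
    ∫ x, Real.exp (-t * ∑ a, (FL (u a) x) ^ 2) ∂(piN K ι)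
      = ∏ a, (1 + 2 * t * (sigK K * ∑ i, ‖u a i‖ ^ 2)) ^ (-(1/2) : ℝ) := by
  have hg : HasGaussianLaw (fun (x : ι → K) a => FL (u a) x) (piN K ι) :=
    ((IsGaussian.hasGaussianLaw_id (μ := piN K ι)).map (ContinuousLinearMap.pi fun a => FL (u a)))
  have hind := hg.iIndepFun_of_covariance_eq_zero (X := fun a => FL (u a)) (fun a b hab => by
    rw [FL_cov, hu a b hab, mul_zero])
  have h3 := hind.integral_fun_prod_comp (f := fun _ y => Real.exp (-t * y ^ 2))
    (fun i => by fun_prop) (fun i => by fun_prop)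
  have e : ∀ x, Real.exp (-t * ∑ a, (FL (u a) x) ^ 2) = ∏ a, Real.exp (-t * (FL (u a) x) ^ 2) := by
    intro x; rw [Finset.mul_sum, Real.exp_sum]
  simp_rw [e]
  rw [h3]
  refine Finset.prod_congr rfl fun a _ => ?_
  have hs : 0 ≤ sigK K * ∑ i, ‖u a i‖ ^ 2 := by rw [← FL_var]; exact variance_nonneg _ _
  have hm := (hg.eval a).map_eq_gaussianReal (X := FL (u a))
  rw [FL_mean, FL_var] at hm
  have := gauss_exp_sq (sigK K * ∑ i, ‖u a i‖ ^ 2).toNNReal t ht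
  rw [← hm, integral_map (by fun_prop) (by fun_prop), Real.coe_toNNReal _ hs] at this
  exact this
end Aux2

section Aux3
variable {K : Type*} [RCLike K] [MeasurableSpace K] [BorelSpace K]

theorem inv_lint (q : ℝ) (hq : 0 ≤ q) :
    (ENNReal.ofReal q)⁻¹ = ∫⁻ t in Set.Ioi (0:ℝ), ENNReal.ofReal (Real.exp (-t * q)) := by
  rcases hq.eq_or_lt with h | h
  · subst h; simp
  · have h1 : ∀ t : ℝ, -t * q = -q * t := fun t => by ring
    simp_rw [h1]
    rw [← ofReal_integral_eq_lintegral_ofReal (integrableOn_exp_mul_Ioi (by linarith) 0)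
      (ae_of_all _ fun t => (Real.exp_pos _).le), integral_exp_mul_Ioi (by linarith)]
    rw [← ENNReal.ofReal_inv_of_pos h]
    congr 1
    simp

theorem pow_lint (c p : ℝ) (hc : 0 < c) (hp : 1 < p) :
    ∫⁻ t in Set.Ioi (0:ℝ), ENNReal.ofReal ((1 + c * t) ^ (-p))
      = ENNReal.ofReal (1 / (c * (p - 1))) := by
  have hd : ∀ t ∈ Set.Ici (0:ℝ), HasDerivAt (fun t => -(1 + c * t) ^ (1 - p) / (c * (p - 1)))
      ((1 + c * t) ^ (-p)) t := by
    intro t ht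
    have ht : 0 ≤ t := ht
    have h0 : 0 < 1 + c * t := by positivity
    have h1 : HasDerivAt (fun t => 1 + c * t) c t := by
      simpa using ((hasDerivAt_id t).const_mul c).const_add 1
    have h2 := ((h1.rpow_const (p := 1 - p) (Or.inl h0.ne')).neg).div_const (c * (p - 1))
    refine h2.congr_deriv ?_
    have : p - 1 ≠ 0 := by linarith
    rw [show 1 - p - 1 = -p by ring]
    field_simp
    ring
  have hnn : ∀ t ∈ Set.Ioi (0:ℝ), 0 ≤ (1 + c * t) ^ (-p) := by
    intro t ht
    have ht : 0 < t := ht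
    positivity
  have hl : Tendsto (fun t => -(1 + c * t) ^ (1 - p) / (c * (p - 1))) atTop (𝓝 0) := by
    have h1 : Tendsto (fun t => 1 + c * t) atTop atTop :=
      tendsto_atTop_add_const_left _ _ (tendsto_id.const_mul_atTop hc)
    have h2 := ((tendsto_rpow_neg_atTop (y := p - 1) (by linarith)).comp h1)
    have h3 := h2.neg.div_const (c * (p - 1))
    simp only [neg_zero, zero_div] at h3
    refine h3.congr fun t => ?_
    simp [show -(p - 1) = 1 - p by ring]
  have hi := integrableOn_Ioi_deriv_of_nonneg' hd hnn hl
  rw [← ofReal_integral_eq_lintegral_ofReal hi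
    ((ae_restrict_iff' measurableSet_Ioi).2 (ae_of_all _ hnn)),
    integral_Ioi_of_hasDerivAt_of_nonneg' hd hnn hl]
  congr 1
  rw [mul_zero, add_zero, Real.one_rpow, zero_sub, neg_div, neg_neg]

theorem inv_moment {ℓ m : ℕ} (e : Fin m → Fin ℓ → K)
    (he : ∀ k k', ∑ i, star (e k i) * e k' i = if k = k' then 1 else 0)
    (hm : 1 + alphaK K < m) :
    ∫⁻ g, (ENNReal.ofReal (∑ k, ‖∑ i, star (e k i) * g i‖ ^ 2))⁻¹ ∂(piN K (Fin ℓ))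
      = ENNReal.ofReal (1 / (m - 1 - alphaK K)) := by
  let u : Fin m × Bool → Fin ℓ → K := fun a i =>
    if a.2 then -RCLike.I * star (e a.1 i) else star (e a.1 i)
  have hq : ∀ g : Fin ℓ → K, ∑ k, ‖∑ i, star (e k i) * g i‖ ^ 2 = ∑ a, (FL (u a) g) ^ 2 := by
    intro g
    rw [Fintype.sum_prod_type]
    refine Finset.sum_congr rfl fun k _ => ?_
    simp only [Fintype.sum_bool, FL_apply, u, if_true, Bool.false_eq_true, if_false]
    rw [sq_norm_K]
    have : ∑ i, -RCLike.I * star (e k i) * g i = -RCLike.I * ∑ i, star (e k i) * g i := by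
      rw [Finset.mul_sum]; exact Finset.sum_congr rfl fun i _ => by ring
    rw [this, RCLike.mul_re]
    generalize (∑ i, star (e k i) * g i) = z
    have hz := RCLike.I_im' z
    simp only [map_neg, RCLike.I_re, neg_zero, zero_mul, zero_sub, neg_mul, neg_neg, hz]
    simp [add_comm]
  have hsum : ∀ k k', ∑ i, star (e k i) * star (star (e k' i)) = if k = k' then 1 else 0 := by
    intro k k'; simp only [star_star]; exact he k k'
  have horth : ∀ a b, a ≠ b → RCLike.re (∑ i, u a i * star (u b i)) = 0 := by
    rintro ⟨k, b⟩ ⟨k', b'⟩ hab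
    have h0 : ∃ c : K, (k = k' → RCLike.re c = 0) ∧
        ∑ i, u (k, b) i * star (u (k', b') i) = c * ∑ i, star (e k i) * star (star (e k' i)) := by
      refine ⟨(if b then -RCLike.I else 1) * star (if b' then -RCLike.I else 1), ?_, ?_⟩
      · rintro rfl
        cases b <;> cases b' <;> simp at hab ⊢
      · rw [Finset.mul_sum]
        refine Finset.sum_congr rfl fun i _ => ?_
        cases b <;> cases b' <;> simp [u] <;> ring
    obtain ⟨c, hc, h0⟩ := h0
    rw [h0, hsum]
    split_ifs with h
    · simpa using hc h
    · simp
  have hn0 : ∀ k, ∑ i, ‖e k i‖ ^ 2 = 1 := by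
    intro k
    have := he k k
    simp only [if_true] at this
    have h2 := congrArg RCLike.re this
    rw [map_sum] at h2
    simp only [RCLike.one_re] at h2
    rw [← h2]
    refine Finset.sum_congr rfl fun i _ => ?_
    rw [RCLike.star_def, RCLike.conj_mul]; norm_cast
  have hnorm : ∀ a, ∑ i, ‖u a i‖ ^ 2 = if a.2 then ‖(RCLike.I : K)‖ ^ 2 else 1 := by
    rintro ⟨k, b⟩
    cases b
    · simp [u, hn0]
    · simp [u, mul_pow, ← Finset.mul_sum, hn0]
  have hstep : ∀ t ∈ Set.Ioi (0:ℝ), ∫⁻ g, ENNReal.ofReal (Real.exp (-t * ∑ a, (FL (u a) g) ^ 2)) ∂(piN K (Fin ℓ))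
      = ENNReal.ofReal (((1 + 2 * t * (sigK K)) ^ (-(1/2) : ℝ) * (1 + 2 * t * (sigK K * ‖(RCLike.I : K)‖ ^ 2)) ^ (-(1/2) : ℝ)) ^ m) := by
    intro t ht
    have ht : 0 < t := ht
    rw [← ofReal_integral_eq_lintegral_ofReal, exp_FL u horth t ht.le]
    · congr 1
      rw [Fintype.prod_prod_type]
      simp only [Fintype.prod_bool, hnorm]
      simp [mul_comm]
    · refine Integrable.of_bound (C := 1) (by fun_prop) (ae_of_all _ fun g => ?_)
      rw [Real.norm_eq_abs, Real.abs_exp, Real.exp_le_one_iff]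
      have : 0 ≤ ∑ a, (FL (u a) g) ^ 2 := Finset.sum_nonneg fun _ _ => sq_nonneg _
      nlinarith
    · exact ae_of_all _ fun g => (Real.exp_pos _).le
  simp_rw [hq]
  have h1 : ∀ g : Fin ℓ → K, (ENNReal.ofReal (∑ a, (FL (u a) g) ^ 2))⁻¹ =
      ∫⁻ t in Set.Ioi (0:ℝ), ENNReal.ofReal (Real.exp (-t * ∑ a, (FL (u a) g) ^ 2)) :=
    fun g => inv_lint _ (Finset.sum_nonneg fun _ _ => sq_nonneg _)
  simp_rw [h1]
  rw [lintegral_lintegral_swap]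
  swap
  · have : Continuous (fun z : (Fin ℓ → K) × ℝ => ENNReal.ofReal (Real.exp (-z.2 * ∑ a, (FL (u a) z.1) ^ 2))) := by
      exact ENNReal.continuous_ofReal.comp (by fun_prop)
    exact this.measurable.aemeasurable
  rw [setLIntegral_congr_fun measurableSet_Ioi hstep]
  by_cases h : (RCLike.I : K) = 0
  · have hs : sigK K = 1 := by simp [sigK, alphaK, h]
    have ha : alphaK K = 1 := by simp [alphaK, h]
    rw [ha] at hm ⊢
    rw [setLIntegral_congr_fun (g := fun t => ENNReal.ofReal ((1 + 2 * t) ^ (-((m:ℝ)/2)))) measurableSet_Ioi, pow_lint]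
    · congr 1
      field_simp
      ring
    · norm_num
    · linarith
    · intro t ht
      have ht : 0 < t := ht
      simp only [hs, h, norm_zero]
      congr 1
      norm_num
      rw [← Real.rpow_natCast, ← Real.rpow_mul (by positivity)]
      congr 1; ring
  · have hs : sigK K = 1/2 := by simp [sigK, alphaK, h]
    have ha : alphaK K = 0 := by simp [alphaK, h]
    have hI : ‖(RCLike.I : K)‖ = 1 := RCLike.norm_I_of_ne_zero h
    rw [ha] at hm ⊢
    rw [setLIntegral_congr_fun (g := fun t => ENNReal.ofReal ((1 + 1 * t) ^ (-(m:ℝ)))) measurableSet_Ioi, pow_lint]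
    · congr 1
      ring
    · norm_num
    · linarith
    · intro t ht
      have ht : 0 < t := ht
      simp only [hs, hI]
      congr 1
      rw [show 1 + 2 * t * (1/2) = 1 + 1 * t by ring, show 1 + 2 * t * (1/2 * 1 ^ 2) = 1 + 1 * t by ring,
        ← Real.rpow_add (by positivity), ← Real.rpow_natCast, ← Real.rpow_mul (by positivity)]
      congr 1; ring
end Aux3

section Aux4
variable {K : Type*} [RCLike K]

theorem det_iff {r ℓ : ℕ} (A : Matrix (Fin r) (Fin ℓ) K) :
    (A * Aᴴ).det ≠ 0 ↔ LinearIndependent K A.row := by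
  rw [← isUnit_iff_ne_zero, ← Matrix.isUnit_iff_isUnit_det, ← Matrix.vecMul_injective_iff_isUnit,
    ← Matrix.vecMul_injective_iff]
  have h1 : ∀ {m n : ℕ} (B : Matrix (Fin m) (Fin n) K), Function.Injective (fun v => v ᵥ* B) ↔
      ∀ v, v ᵥ* B = 0 → v = 0 := by
    intro m n B
    exact injective_iff_map_eq_zero B.vecMulLinear
  rw [h1, h1]
  simp_rw [Matrix.vecMul_self_mul_conjTranspose_eq_zero]

theorem exists_basis {r ℓ : ℕ} (A : Matrix (Fin r) (Fin ℓ) K) (hA : LinearIndependent K A.row) :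
    ∃ (m : ℕ) (e : Fin m → Fin ℓ → K), m + r = ℓ ∧
      (∀ k k', ∑ i, star (e k i) * e k' i = if k = k' then 1 else 0) ∧
      (∀ k j, ∑ i, star (e k i) * A j i = 0) ∧
      (∀ x : Fin ℓ → K, (∀ j, ∑ i, star (A j i) * x i = 0) →
        ∑ i, ‖x i‖ ^ 2 = ∑ k, ‖∑ i, star (e k i) * x i‖ ^ 2) := by
  let a : Fin r → EuclideanSpace K (Fin ℓ) := fun j => WithLp.toLp 2 (A j)
  have hin : ∀ x y : EuclideanSpace K (Fin ℓ), inner K x y = ∑ i, star (x i) * y i := by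
    intro x y
    rw [PiLp.inner_apply]
    simp [mul_comm]
  have ha : LinearIndependent K a :=
    hA.map' (WithLp.linearEquiv 2 K (Fin ℓ → K)).symm.toLinearMap (LinearEquiv.ker _)
  let W := Submodule.span K (Set.range a)
  have hW : Module.finrank K W = r := by
    rw [finrank_span_eq_card ha]; simp
  have hdim := Submodule.finrank_add_finrank_orthogonal W
  rw [hW, finrank_euclideanSpace_fin] at hdim
  let b := stdOrthonormalBasis K Wᗮ
  refine ⟨Module.finrank K Wᗮ, fun k i => (b k : EuclideanSpace K (Fin ℓ)) i, by omega, ?_, ?_, ?_⟩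
  · intro k k'
    rw [← hin, ← Submodule.coe_inner]
    exact orthonormal_iff_ite.1 b.orthonormal k k'
  · intro k j
    have h1 : a j ∈ W := Submodule.subset_span ⟨j, rfl⟩
    have := Submodule.inner_left_of_mem_orthogonal h1 (b k).2
    rw [hin] at this
    exact this
  · intro x hx
    let x' : EuclideanSpace K (Fin ℓ) := WithLp.toLp 2 x
    have hx' : x' ∈ Wᗮ := by
      rw [Submodule.mem_orthogonal]
      intro w hw
      induction hw using Submodule.span_induction with
      | mem w hw =>
        obtain ⟨j, rfl⟩ := hw
        rw [hin]; exact hx j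
      | zero => simp
      | add u v _ _ hu hv => rw [inner_add_left, hu, hv, add_zero]
      | smul c u _ hu => rw [inner_smul_left, hu, mul_zero]
    have := b.sum_sq_norm_inner_right ⟨x', hx'⟩
    rw [Submodule.coe_norm, EuclideanSpace.norm_sq_eq] at this
    rw [← this]
    refine Finset.sum_congr rfl fun k _ => ?_
    rw [Submodule.coe_inner, hin]

theorem row_norm {r ℓ : ℕ} (A : Matrix (Fin (r + 1)) (Fin ℓ) K) (i : Fin (r + 1))
    (hA : (A * Aᴴ).det ≠ 0) {m : ℕ} (e : Fin m → Fin ℓ → K)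
    (h1 : ∀ k j, ∑ l, star (e k l) * A (i.succAbove j) l = 0)
    (h2 : ∀ x : Fin ℓ → K, (∀ j, ∑ l, star (A (i.succAbove j) l) * x l = 0) →
        ∑ l, ‖x l‖ ^ 2 = ∑ k, ‖∑ l, star (e k l) * x l‖ ^ 2) :
    ENNReal.ofReal (∑ l, ‖((A * Aᴴ)⁻¹ * A) i l‖ ^ 2)
      = (ENNReal.ofReal (∑ k, ‖∑ l, star (e k l) * A i l‖ ^ 2))⁻¹ := by
  have hu : IsUnit (A * Aᴴ).det := isUnit_iff_ne_zero.2 hA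
  have hh : ((A * Aᴴ)⁻¹)ᴴ = (A * Aᴴ)⁻¹ := (Matrix.isHermitian_mul_conjTranspose_self A).inv
  have hT : A * ((A * Aᴴ)⁻¹ * A)ᴴ = 1 := by
    rw [Matrix.conjTranspose_mul, hh, ← Matrix.mul_assoc, Matrix.mul_nonsing_inv _ hu]
  have hN : ((A * Aᴴ)⁻¹ * A) * ((A * Aᴴ)⁻¹ * A)ᴴ = (A * Aᴴ)⁻¹ := by
    rw [Matrix.mul_assoc, hT, Matrix.mul_one]
  have hy : ∀ j, ∑ l, star (A j l) * ((A * Aᴴ)⁻¹ * A) i l = if j = i then 1 else 0 := by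
    intro j
    have := congrArg star (congrFun (congrFun hT j) i)
    rw [Matrix.mul_apply, Matrix.one_apply, star_sum] at this
    simp only [Matrix.conjTranspose_apply, star_mul', star_star] at this
    rw [this]; split_ifs <;> simp
  have hn : (A * Aᴴ)⁻¹ i i = ((∑ l, ‖((A * Aᴴ)⁻¹ * A) i l‖ ^ 2 : ℝ) : K) := by
    have := congrFun (congrFun hN i) i
    rw [Matrix.mul_apply] at this
    rw [← this]
    push_cast
    refine Finset.sum_congr rfl fun l _ => ?_
    rw [Matrix.conjTranspose_apply, RCLike.star_def, RCLike.mul_conj]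
  have h3 := h2 (((A * Aᴴ)⁻¹ * A) i) (fun j => by
    rw [hy]; simp [Fin.succAbove_ne])
  have h4 : ∀ k, ∑ l, star (e k l) * ((A * Aᴴ)⁻¹ * A) i l
      = (A * Aᴴ)⁻¹ i i * ∑ l, star (e k l) * A i l := by
    intro k
    have : ∑ l, star (e k l) * ((A * Aᴴ)⁻¹ * A) i l
      = ∑ j, (A * Aᴴ)⁻¹ i j * ∑ l, star (e k l) * A j l := by
      simp_rw [Matrix.mul_apply (M := (A * Aᴴ)⁻¹), Finset.mul_sum]
      rw [Finset.sum_comm]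
      refine Finset.sum_congr rfl fun j _ => Finset.sum_congr rfl fun l _ => by ring
    rw [this, Fin.sum_univ_succAbove _ i]
    simp only [h1, mul_zero, Finset.sum_const_zero, add_zero]
  have h5 : ∑ l, ‖((A * Aᴴ)⁻¹ * A) i l‖ ^ 2 ≠ 0 := by
    intro h0
    have h6 : ∀ l, ((A * Aᴴ)⁻¹ * A) i l = 0 := by
      intro l
      have := (Finset.sum_eq_zero_iff_of_nonneg (fun l _ => by positivity)).1 h0 l (Finset.mem_univ _)
      simpa using this
    have := hy i
    simp [h6] at this
  simp_rw [h4, hn, norm_mul, mul_pow] at h3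
  rw [← Finset.mul_sum] at h3
  set n := ∑ l, ‖((A * Aᴴ)⁻¹ * A) i l‖ ^ 2 with hndef
  set q := ∑ k, ‖∑ l, star (e k l) * A i l‖ ^ 2 with hq
  have hn0 : 0 ≤ n := Finset.sum_nonneg fun _ _ => by positivity
  have hq0 : 0 ≤ q := Finset.sum_nonneg fun _ _ => by positivity
  rw [RCLike.norm_ofReal, sq_abs] at h3
  have hqn : n * q = 1 := by
    have : n * (n * q - 1) = 0 := by linarith
    rcases mul_eq_zero.1 this with h | h
    · exact absurd h h5
    · linarith
  have hq1 : 0 < q := lt_of_le_of_ne hq0 (by rintro h; rw [← h] at hqn; simp at hqn)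
  rw [← ENNReal.ofReal_inv_of_pos hq1]
  congr 1
  field_simp; linarith

theorem pinv_eq {r ℓ : ℕ} (A : Matrix (Fin r) (Fin ℓ) K) (hA : (A * Aᴴ).det ≠ 0)
    (X : Matrix (Fin r) (Fin ℓ) K) (hX : IsMoorePenrose Aᴴ X) : X = (A * Aᴴ)⁻¹ * A := by
  have hu : IsUnit (A * Aᴴ).det := isUnit_iff_ne_zero.2 hA
  obtain ⟨h1, -, h3, -⟩ := hX
  have : A * Aᴴ * X = A := by
    have := congrArg conjTranspose h1
    rw [Matrix.conjTranspose_mul, h3, Matrix.conjTranspose_conjTranspose, ← Matrix.mul_assoc] at this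
    exact this
  calc X = (A * Aᴴ)⁻¹ * (A * Aᴴ * X) := by
        rw [← Matrix.mul_assoc, Matrix.nonsing_inv_mul _ hu, Matrix.one_mul]
    _ = _ := by rw [this]

theorem li_of_q {r ℓ : ℕ} (A : Matrix (Fin (r + 1)) (Fin ℓ) K) (i : Fin (r + 1))
    (hA : LinearIndependent K (fun j : Fin r => A (i.succAbove j))) {m : ℕ} (e : Fin m → Fin ℓ → K)
    (h1 : ∀ k (j : Fin r), ∑ l, star (e k l) * A (i.succAbove j) l = 0)
    (hq : ∑ k, ‖∑ l, star (e k l) * A i l‖ ^ 2 ≠ 0) : (A * Aᴴ).det ≠ 0 := by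
  rw [det_iff, ← linearIndependent_equiv (finSuccEquiv' i).symm, linearIndependent_option]
  have e1 : ((A.row ∘ (finSuccEquiv' i).symm) ∘ ((↑) : Fin r → Option (Fin r)))
      = fun j : Fin r => A (i.succAbove j) := by
    ext j l; simp
  have e2 : (A.row ∘ (finSuccEquiv' i).symm) none = A i := by ext l; simp
  rw [e1, e2]
  refine ⟨hA, fun hmem => hq ?_⟩
  refine Finset.sum_eq_zero fun k _ => ?_
  have : ∀ x ∈ Submodule.span K (Set.range fun j : Fin r => A (i.succAbove j)),
      ∑ l, star (e k l) * x l = 0 := by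
    intro x hmem
    induction hmem using Submodule.span_induction with
    | mem w hw => obtain ⟨j, rfl⟩ := hw; exact h1 k j
    | zero => simp
    | add u v _ _ hu hv =>
      simp only [Pi.add_apply, mul_add, Finset.sum_add_distrib, hu, hv, add_zero]
    | smul c u _ hu =>
      have : ∑ l, star (e k l) * (c • u) l = c * ∑ l, star (e k l) * u l := by
        rw [Finset.mul_sum]; exact Finset.sum_congr rfl fun l _ => by simp; ring
      rw [this, hu, mul_zero]
  rw [this _ hmem]; simp
end Aux4

section Aux5
variable {K : Type*} [RCLike K] [MeasurableSpace K] [BorelSpace K]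

/-- iid rows -/
def piM (K : Type*) [RCLike K] [MeasurableSpace K] (r ℓ : ℕ) : Measure (Fin r → Fin ℓ → K) :=
  Measure.pi fun _ => piN K (Fin ℓ)

/-- pseudoinverse formula -/
def pv {r ℓ : ℕ} (A : Fin r → Fin ℓ → K) : Matrix (Fin r) (Fin ℓ) K :=
  (Matrix.of A * (Matrix.of A)ᴴ)⁻¹ * Matrix.of A

/-- Gram determinant -/
def gd {r ℓ : ℕ} (A : Fin r → Fin ℓ → K) : K := (Matrix.of A * (Matrix.of A)ᴴ).det

theorem of_continuous {r ℓ : ℕ} :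
    Continuous (fun A : Fin r → Fin ℓ → K => Matrix.of A) := continuous_id

theorem gd_continuous {r ℓ : ℕ} : Continuous (gd : (Fin r → Fin ℓ → K) → K) := by
  unfold gd
  exact (of_continuous.matrix_mul of_continuous.matrix_conjTranspose).matrix_det

theorem pv_measurable {r ℓ : ℕ} (i : Fin r) (l : Fin ℓ) :
    Measurable (fun A : Fin r → Fin ℓ → K => pv A i l) := by
  have : ∀ A : Fin r → Fin ℓ → K, pv A i l = (gd A)⁻¹ *
      ((Matrix.of A * (Matrix.of A)ᴴ).adjugate * Matrix.of A) i l := by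
    intro A
    rw [pv, Matrix.inv_def, Ring.inverse_eq_inv', Matrix.smul_mul, Matrix.smul_apply, smul_eq_mul, gd]
  simp_rw [this]
  refine gd_continuous.measurable.inv.mul (Continuous.measurable ?_)
  exact ((of_continuous.matrix_mul of_continuous.matrix_conjTranspose).matrix_adjugate.matrix_mul
    of_continuous).matrix_elem i l

theorem inner_step {r ℓ : ℕ} (hr : ((r + 1 : ℕ) : ℝ) + alphaK K < ℓ) (i : Fin (r + 1))
    (R : Fin r → Fin ℓ → K) (hR : gd R ≠ 0) :
    (∀ᵐ g ∂(piN K (Fin ℓ)), gd (i.insertNth (α := fun _ => Fin ℓ → K) g R) ≠ 0) ∧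
    ∫⁻ g, ENNReal.ofReal (∑ l, ‖pv (i.insertNth (α := fun _ => Fin ℓ → K) g R) i l‖ ^ 2) ∂(piN K (Fin ℓ))
      = ENNReal.ofReal (1 / (ℓ - (r + 1 : ℕ) - alphaK K)) := by
  have hli : LinearIndependent K (Matrix.of R).row := (det_iff _).1 hR
  obtain ⟨m, e, hm, he, h1, h2⟩ := exists_basis (Matrix.of R) hli
  have hm' : (m : ℝ) + r = ℓ := by exact_mod_cast hm
  have hmom := inv_moment e he (by push_cast at hr; linarith)
  have hae : ∀ᵐ g ∂(piN K (Fin ℓ)), gd (i.insertNth (α := fun _ => Fin ℓ → K) g R) ≠ 0 := by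
    have hmeas : Measurable fun g : Fin ℓ → K =>
        (ENNReal.ofReal (∑ k, ‖∑ i, star (e k i) * g i‖ ^ 2))⁻¹ := by
      refine (ENNReal.measurable_ofReal.comp (Continuous.measurable ?_)).inv
      fun_prop
    filter_upwards [ae_lt_top hmeas (by rw [hmom]; exact ENNReal.ofReal_ne_top)] with g hg
    refine li_of_q (Matrix.of (i.insertNth (α := fun _ => Fin ℓ → K) g R)) i ?_ e ?_ ?_
    · have hfun : (fun j => Matrix.of (i.insertNth (α := fun _ => Fin ℓ → K) g R) (i.succAbove j))
          = (Matrix.of R).row := by ext j l; simp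
      rw [hfun]; exact hli
    · simpa using h1
    · intro h0
      simp only [Matrix.of_apply, Fin.insertNth_apply_same] at h0
      rw [h0] at hg
      simp at hg
  refine ⟨hae, ?_⟩
  have hc : (m : ℝ) - 1 - alphaK K = ℓ - (r + 1 : ℕ) - alphaK K := by push_cast; linarith
  rw [← hc, ← hmom]
  refine lintegral_congr_ae ?_
  filter_upwards [hae] with g hg
  have := row_norm (Matrix.of (i.insertNth (α := fun _ => Fin ℓ → K) g R)) i hg e
    (by simpa using h1) (by simpa using h2)
  rw [pv, this]
  simp

theorem piM_mp (r ℓ : ℕ) (i : Fin (r + 1)) :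
    MeasurePreserving (fun z : (Fin ℓ → K) × (Fin r → Fin ℓ → K) =>
      i.insertNth (α := fun _ => Fin ℓ → K) z.1 z.2)
      ((piN K (Fin ℓ)).prod (piM K r ℓ)) (piM K (r + 1) ℓ) :=
  (measurePreserving_piFinSuccAbove (fun _ : Fin (r + 1) => piN K (Fin ℓ)) i).symm

instance piM_prob {r ℓ : ℕ} : IsProbabilityMeasure (piM K r ℓ) := by unfold piM; infer_instance

theorem ae_gd {ℓ : ℕ} : ∀ r : ℕ, (r : ℝ) + alphaK K < ℓ → ∀ᵐ A ∂(piM K r ℓ), gd A ≠ 0 := by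
  intro r
  induction r with
  | zero => intro _; exact ae_of_all _ fun A => by simp [gd]
  | succ r ih =>
    intro hr
    have ih := ih (by push_cast at hr; linarith)
    have hs : MeasurableSet {A : Fin (r + 1) → Fin ℓ → K | gd A ≠ 0} :=
      gd_continuous.measurable (measurableSet_singleton 0).compl
    have mp := piM_mp (K := K) r ℓ 0
    have hs2 := (mp.measurable hs).compl
    rw [← mp.map_eq, ae_map_iff mp.measurable.aemeasurable hs, ae_iff]
    change ((piN K (Fin ℓ)).prod (piM K r ℓ)) (((fun z : (Fin ℓ → K) × (Fin r → Fin ℓ → K) =>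
      (0 : Fin (r + 1)).insertNth (α := fun _ => Fin ℓ → K) z.1 z.2) ⁻¹'
        {A : Fin (r + 1) → Fin ℓ → K | gd A ≠ 0})ᶜ) = 0
    rw [Measure.prod_apply_symm hs2]
    rw [lintegral_eq_zero_iff' ?_]
    · filter_upwards [ih] with R hR
      exact (inner_step hr 0 R hR).1
    · exact (measurable_measure_prodMk_right (mp.measurable hs).compl).aemeasurable

theorem row_moment {r ℓ : ℕ} (hr : (r : ℝ) + alphaK K < ℓ) (i : Fin r) :
    ∫⁻ A, ENNReal.ofReal (∑ l, ‖pv A i l‖ ^ 2) ∂(piM K r ℓ)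
      = ENNReal.ofReal (1 / (ℓ - r - alphaK K)) := by
  cases r with
  | zero => exact i.elim0
  | succ r =>
    have mp := piM_mp (K := K) r ℓ i
    have hm : Measurable fun A : Fin (r + 1) → Fin ℓ → K => ENNReal.ofReal (∑ l, ‖pv A i l‖ ^ 2) :=
      ENNReal.measurable_ofReal.comp
        (Finset.measurable_sum _ fun l _ => (pv_measurable i l).norm.pow_const 2)
    have hm2 : Measurable (fun a : (Fin ℓ → K) × (Fin r → Fin ℓ → K) => ENNReal.ofReal
        (∑ l, ‖pv (i.insertNth (α := fun _ => Fin ℓ → K) a.1 a.2) i l‖ ^ 2)) :=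
      hm.comp mp.measurable
    rw [← mp.lintegral_comp hm, lintegral_prod_symm _ hm2.aemeasurable]
    have : ∀ᵐ R ∂(piM K r ℓ), ∫⁻ g, ENNReal.ofReal (∑ l, ‖pv (i.insertNth (α := fun _ => Fin ℓ → K) g R) i l‖ ^ 2) ∂(piN K (Fin ℓ))
      = ENNReal.ofReal (1 / (ℓ - (r + 1 : ℕ) - alphaK K)) := by
      filter_upwards [ae_gd (K := K) (ℓ := ℓ) r (by push_cast at hr; linarith)] with R hR
      exact (inner_step hr i R hR).2
    rw [lintegral_congr_ae this]
    simp

theorem frob_moment {r ℓ : ℕ} (hr : (r : ℝ) + alphaK K < ℓ) :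
    ∫⁻ A, ENNReal.ofReal (frobSq (pv A)) ∂(piM K r ℓ)
      = ENNReal.ofReal (r / (ℓ - r - alphaK K)) := by
  unfold frobSq
  have : ∀ A : Fin r → Fin ℓ → K, ENNReal.ofReal (∑ i, ∑ l, ‖pv A i l‖ ^ 2)
    = ∑ i, ENNReal.ofReal (∑ l, ‖pv A i l‖ ^ 2) := fun A =>
      ENNReal.ofReal_sum_of_nonneg fun i _ => Finset.sum_nonneg fun _ _ => by positivity
  simp_rw [this]
  rw [lintegral_finsetSum]
  · simp_rw [row_moment hr]
    have h0 : 0 < (ℓ : ℝ) - r - alphaK K := by linarith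
    rw [← ENNReal.ofReal_sum_of_nonneg (fun i _ => by positivity)]
    congr 1
    simp; rfl
  · intro i _
    exact ENNReal.measurable_ofReal.comp
        (Finset.measurable_sum _ fun l _ => (pv_measurable i l).norm.pow_const 2)
end Aux5

section Aux6
variable {K : Type*} [RCLike K] [MeasurableSpace K] [BorelSpace K]

theorem real_moment {s ℓ : ℕ} (c : Fin s → Fin ℓ → K) :
    Integrable (fun w : Fin s → Fin ℓ → K => (RCLike.re (∑ l, ∑ k, c l k * w l k)) ^ 2) (piM K s ℓ) ∧
    ∫ w : Fin s → Fin ℓ → K, (RCLike.re (∑ l, ∑ k, c l k * w l k)) ^ 2 ∂(piM K s ℓ)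
      = sigK K * ∑ l, ∑ k, ‖c l k‖ ^ 2 := by
  have he : (fun w : Fin s → Fin ℓ → K => RCLike.re (∑ l, ∑ k, c l k * w l k))
      = ∑ l, fun w : Fin s → Fin ℓ → K => FL (c l) (w l) := by
    ext w
    rw [Finset.sum_apply, map_sum]
    simp only [FL_apply]
  have hml : ∀ l, MemLp (fun w : Fin s → Fin ℓ → K => FL (c l) (w l)) 2 (piM K s ℓ) := fun l =>
    (FL_memLp (c l)).comp_measurePreserving
      (measurePreserving_eval (fun _ : Fin s => piN K (Fin ℓ)) l)
  have hm : MemLp (fun w : Fin s → Fin ℓ → K => RCLike.re (∑ l, ∑ k, c l k * w l k)) 2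
      (piM K s ℓ) := by
    rw [he]; exact memLp_finsetSum' _ fun l _ => hml l
  have hv : Var[fun w : Fin s → Fin ℓ → K => RCLike.re (∑ l, ∑ k, c l k * w l k); piM K s ℓ]
      = sigK K * ∑ l, ∑ k, ‖c l k‖ ^ 2 := by
    rw [he, piM, variance_sum_pi (μ := fun _ : Fin s => piN K (Fin ℓ))
      (X := fun l x => FL (c l) x) (fun l => FL_memLp (c l)), Finset.mul_sum]
    exact Finset.sum_congr rfl fun l _ => FL_var (c l)
  have h0 : ∫ w : Fin s → Fin ℓ → K, RCLike.re (∑ l, ∑ k, c l k * w l k) ∂(piM K s ℓ) = 0 := by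
    have : ∀ w : Fin s → Fin ℓ → K, RCLike.re (∑ l, ∑ k, c l k * w l k) = ∑ l, FL (c l) (w l) := by
      intro w
      rw [map_sum]
      simp only [FL_apply]
    simp_rw [this]
    rw [integral_finsetSum _ (fun l _ => (hml l).integrable (by norm_num))]
    refine Finset.sum_eq_zero fun l _ => ?_
    have := integral_comp_eval (μ := fun _ : Fin s => piN K (Fin ℓ)) (f := fun x => FL (c l) x)
      (i := l) (by fun_prop)
    rw [piM, this]; exact FL_mean (c l)
  refine ⟨hm.integrable_sq, ?_⟩
  rw [← hv, variance_of_integral_eq_zero hm.aemeasurable h0]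

theorem sig_I : sigK K + sigK K * ‖(RCLike.I : K)‖ ^ 2 = 1 := by
  by_cases h : (RCLike.I : K) = 0
  · simp [sigK, alphaK, h]
  · rw [RCLike.norm_I_of_ne_zero h]; simp [sigK, alphaK, h]; norm_num

theorem cplx_moment {s ℓ : ℕ} (c : Fin s → Fin ℓ → K) :
    ∫⁻ w : Fin s → Fin ℓ → K, ENNReal.ofReal (‖∑ l, ∑ k, c l k * w l k‖ ^ 2) ∂(piM K s ℓ)
      = ENNReal.ofReal (∑ l, ∑ k, ‖c l k‖ ^ 2) := by
  obtain ⟨i1, e1⟩ := real_moment c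
  obtain ⟨i2, e2⟩ := real_moment (fun l k => (RCLike.I : K) * c l k)
  have hd : ∀ w : Fin s → Fin ℓ → K, ‖∑ l, ∑ k, c l k * w l k‖ ^ 2 =
      (RCLike.re (∑ l, ∑ k, c l k * w l k)) ^ 2 +
      (RCLike.re (∑ l, ∑ k, (RCLike.I : K) * c l k * w l k)) ^ 2 := by
    intro w
    have : ∑ l, ∑ k, (RCLike.I : K) * c l k * w l k = RCLike.I * ∑ l, ∑ k, c l k * w l k := by
      simp only [Finset.mul_sum, mul_assoc]
    rw [this, RCLike.I_mul_re, sq_norm_K]; ring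
  simp_rw [hd]
  have hi := ofReal_integral_eq_lintegral_ofReal (i1.add i2) (ae_of_all _ fun w => by
    simp only [Pi.add_apply, Pi.zero_apply]; positivity)
  simp only [Pi.add_apply] at hi
  rw [← hi]
  congr 1
  rw [integral_add i1 i2, e1, e2]
  simp only [norm_mul, mul_pow, ← Finset.mul_sum]
  rw [← mul_assoc, ← add_mul, sig_I, one_mul]

theorem mat_moment {r s ℓ p : ℕ} (X : Matrix (Fin r) (Fin ℓ) K) (B : Matrix (Fin s) (Fin p) K) :
    ∫⁻ w : Fin s → Fin ℓ → K, ENNReal.ofReal (frobSq (X * ((Matrix.of w)ᴴ * B))) ∂(piM K s ℓ)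
      = ENNReal.ofReal (frobSq X * frobSq B) := by
  have hent : ∀ (w : Fin s → Fin ℓ → K) i j, ‖(X * ((Matrix.of w)ᴴ * B)) i j‖ =
      ‖∑ l, ∑ k, (star (X i k) * star (B l j)) * w l k‖ := by
    intro w i j
    rw [← norm_star]
    congr 1
    simp only [Matrix.mul_apply, Matrix.conjTranspose_apply, Matrix.of_apply, star_sum, star_mul',
      star_star, Finset.mul_sum]
    rw [Finset.sum_comm]
    refine Finset.sum_congr rfl fun l _ => Finset.sum_congr rfl fun k _ => by ring
  have hsum : ∀ w : Fin s → Fin ℓ → K, ENNReal.ofReal (frobSq (X * ((Matrix.of w)ᴴ * B))) =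
      ∑ i, ∑ j, ENNReal.ofReal (‖∑ l, ∑ k, (star (X i k) * star (B l j)) * w l k‖ ^ 2) := by
    intro w
    rw [frobSq, ENNReal.ofReal_sum_of_nonneg fun i _ => Finset.sum_nonneg fun _ _ => by positivity]
    refine Finset.sum_congr rfl fun i _ => ?_
    rw [ENNReal.ofReal_sum_of_nonneg fun i _ => by positivity]
    simp only [hent]
  have hmeas : ∀ i j, Measurable fun w : Fin s → Fin ℓ → K =>
      ENNReal.ofReal (‖∑ l, ∑ k, (star (X i k) * star (B l j)) * w l k‖ ^ 2) := by
    intro i j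
    refine ENNReal.measurable_ofReal.comp (Continuous.measurable ?_)
    fun_prop
  simp_rw [hsum]
  rw [lintegral_finsetSum _ (fun i _ => Finset.measurable_sum _ fun j _ => hmeas i j)]
  simp_rw [lintegral_finsetSum _ (fun j _ => hmeas _ j), cplx_moment]
  have hs : ∀ i, ∑ j, ENNReal.ofReal (∑ l, ∑ k, ‖star (X i k) * star (B l j)‖ ^ 2)
      = ENNReal.ofReal (∑ j, ∑ l, ∑ k, ‖star (X i k) * star (B l j)‖ ^ 2) := fun i =>
    (ENNReal.ofReal_sum_of_nonneg fun j _ => by positivity).symm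
  simp_rw [hs]
  rw [← ENNReal.ofReal_sum_of_nonneg fun j _ => by positivity]
  congr 1
  simp only [norm_mul, norm_star, mul_pow, frobSq]
  rw [Finset.sum_mul]
  refine Finset.sum_congr rfl fun i _ => ?_
  simp only [← Finset.sum_mul, ← Finset.mul_sum]
  rw [Finset.sum_comm]

theorem gm_eq (n ℓ : ℕ) : gaussianMatrix K n ℓ = piM K n ℓ := by
  have h1 : Measure.map (fun (x : Fin ℓ → Bool → ℝ) j => stdGaussianEntry K (x j))
      (Measure.pi fun _ : Fin ℓ => Measure.pi fun _ : Bool => gaussianReal 0 1) = piN K (Fin ℓ) := by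
    rw [Measure.pi_map_pi (fun _ => entry_continuous.measurable.aemeasurable)]; rfl
  have hm : Measurable (fun (x : Fin ℓ → Bool → ℝ) j => stdGaussianEntry K (x j)) :=
    measurable_pi_lambda _ fun j => entry_continuous.measurable.comp (measurable_pi_apply j)
  have h2 := Measure.pi_map_pi
    (μ := fun _ : Fin n => Measure.pi fun _ : Fin ℓ => Measure.pi fun _ : Bool => gaussianReal 0 1)
    (f := fun _ => fun (x : Fin ℓ → Bool → ℝ) j => stdGaussianEntry K (x j))
    (fun _ => hm.aemeasurable)
  simp only [h1] at h2
  exact h2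

theorem split_mp (r s ℓ : ℕ) :
    MeasurePreserving (fun w : Fin (r + s) → Fin ℓ → K =>
      ((fun i => w (Fin.castAdd s i), fun i => w (Fin.natAdd r i)) :
        (Fin r → Fin ℓ → K) × (Fin s → Fin ℓ → K)))
      (piM K (r + s) ℓ) ((piM K r ℓ).prod (piM K s ℓ)) := by
  have h1 := (measurePreserving_piCongrLeft (fun _ : Fin (r + s) => piN K (Fin ℓ))
    (finSumFinEquiv (m := r) (n := s))).symm
  have h2 := measurePreserving_sumPiEquivProdPi (fun _ : Fin r ⊕ Fin s => piN K (Fin ℓ))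
  exact h2.comp h1
end Aux6

theorem core_moment
    {K : Type*} [RCLike K] [MeasurableSpace K] [BorelSpace K] (r s ℓ p : ℕ)
    (hr : (r : ℝ) + alphaK K < (ℓ : ℝ)) (B : Matrix (Fin s) (Fin p) K) :
    Measurable (fun z : (Fin r → Fin ℓ → K) × (Fin s → Fin ℓ → K) =>
      frobSq (pv z.1 * ((Matrix.of z.2)ᴴ * B))) ∧
    ∫⁻ z : (Fin r → Fin ℓ → K) × (Fin s → Fin ℓ → K),
      ENNReal.ofReal (frobSq (pv z.1 * ((Matrix.of z.2)ᴴ * B))) ∂((piM K r ℓ).prod (piM K s ℓ))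
      = ENNReal.ofReal ((r : ℝ) / ((ℓ : ℝ) - (r : ℝ) - alphaK K) * frobSq B) := by
  have hm : Measurable (fun z : (Fin r → Fin ℓ → K) × (Fin s → Fin ℓ → K) =>
      frobSq (pv z.1 * ((Matrix.of z.2)ᴴ * B))) := by
    unfold frobSq
    refine Finset.measurable_sum _ fun i _ => Finset.measurable_sum _ fun j _ => ?_
    refine Measurable.pow_const (Measurable.norm ?_) 2
    simp only [Matrix.mul_apply]
    refine Finset.measurable_sum _ fun k _ => ?_
    refine ((pv_measurable i k).comp measurable_fst).mul (Continuous.measurable ?_)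
    simp only [Matrix.conjTranspose_apply, Matrix.of_apply]
    fun_prop
  refine ⟨hm, ?_⟩
  have hm2 : Measurable (fun z : (Fin r → Fin ℓ → K) × (Fin s → Fin ℓ → K) =>
      ENNReal.ofReal (frobSq (pv z.1 * ((Matrix.of z.2)ᴴ * B)))) :=
    ENNReal.measurable_ofReal.comp hm
  rw [lintegral_prod _ hm2.aemeasurable]
  simp_rw [mat_moment]
  have hB : 0 ≤ frobSq B := by unfold frobSq; positivity
  have h0 : 0 < (ℓ : ℝ) - r - alphaK K := by linarith
  simp_rw [ENNReal.ofReal_mul' hB]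
  rw [lintegral_mul_const' _ _ ENNReal.ofReal_ne_top, frob_moment hr]

/-- **Gaussian sketching identity** (Proposition 5.2): for a Gaussian embedding
`Ω ∈ K^{(r+s)×ℓ}` partitioned into its first `r` rows `Ω₁` and last `s` rows `Ω₂`,
with `r + α_K < ℓ`, and any `B`, `E‖(Ω₁*)⁺Ω₂*B‖_F² = (r/(ℓ − r − α_K))‖B‖_F²`. -/
theorem gaussian_sketching_identity
    {K : Type*} [RCLike K] [MeasurableSpace K] [BorelSpace K]
    {Y : Type*} [MeasurableSpace Y] (μ : Measure Y) [IsProbabilityMeasure μ]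
    (pinv : (m n : ℕ) → Matrix (Fin m) (Fin n) K → Matrix (Fin n) (Fin m) K)
    (hpinv : ∀ (m n : ℕ) (A : Matrix (Fin m) (Fin n) K), IsMoorePenrose A (pinv m n A))
    (r s ℓ p : ℕ) (hℓ : ℓ ≤ r + s)
    (M : Y → Matrix (Fin (r + s)) (Fin ℓ) K)
    (hM : IsGaussianEmbedding μ M)
    (hr : (r : ℝ) + alphaK K < (ℓ : ℝ))
    (B : Matrix (Fin s) (Fin p) K) :
    ∫ ω, frobSq (pinv ℓ r (((M ω).submatrix (Fin.castAdd s) id)ᴴ) *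
        (((M ω).submatrix (Fin.natAdd r) id)ᴴ * B)) ∂μ
      = (r : ℝ) / ((ℓ : ℝ) - (r : ℝ) - alphaK K) * frobSq B := by
  have hB : 0 ≤ frobSq B := by unfold frobSq; positivity
  have h0 : 0 < (ℓ : ℝ) - r - alphaK K := by linarith
  obtain ⟨hcm, hcore⟩ := core_moment r s ℓ p hr B
  have mpM : MeasurePreserving M μ (piM K (r + s) ℓ) := ⟨hM.1, hM.2.trans (gm_eq (r + s) ℓ)⟩
  have mp : MeasurePreserving (fun ω => ((fun i => M ω (Fin.castAdd s i),
      fun i => M ω (Fin.natAdd r i)) : (Fin r → Fin ℓ → K) × (Fin s → Fin ℓ → K)))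
      μ ((piM K r ℓ).prod (piM K s ℓ)) := (split_mp r s ℓ).comp mpM
  have hae : ∀ᵐ ω ∂μ, gd (fun i => M ω (Fin.castAdd s i)) ≠ 0 :=
    (measurePreserving_fst.comp mp).quasiMeasurePreserving.ae (ae_gd (K := K) r hr)
  have hcongr : ∀ᵐ ω ∂μ, frobSq (pinv ℓ r (((M ω).submatrix (Fin.castAdd s) id)ᴴ) *
        (((M ω).submatrix (Fin.natAdd r) id)ᴴ * B)) =
      frobSq (pv (fun i => M ω (Fin.castAdd s i)) *
        ((Matrix.of (fun i => M ω (Fin.natAdd r i)))ᴴ * B)) := by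
    filter_upwards [hae] with ω hω
    have := pinv_eq ((M ω).submatrix (Fin.castAdd s) id) hω _ (hpinv ℓ r _)
    rw [this]
    rfl
  rw [integral_congr_ae hcongr, integral_eq_lintegral_of_nonneg_ae]
  · have h3 := mp.lintegral_comp (ENNReal.measurable_ofReal.comp hcm)
    simp only [Function.comp_apply] at h3
    rw [h3, hcore, ENNReal.toReal_ofReal (by positivity)]
  · exact ae_of_all _ fun ω => by simp only [Pi.zero_apply]; unfold frobSq; positivity
  · exact (hcm.comp mp.measurable).aestronglyMeasurable
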